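/- arXiv:2405.07226 — 4 statements merged into one kernel-verified Lean document; each statement's English description precedes it below -/
import Mathlib

section
/- Let d ≥ 2 and let A, B, C, D be complex d×d matrices. Then ∫ Tr(W·A·W†·B·W·C·W†·D) dHaar_d(W) = (Tr(AC)·Tr(B)·Tr(D) + Tr(A)·Tr(C)·Tr(BD)) / (d² − 1) − (Tr(A)·Tr(B)·Tr(C)·Tr(D) + Tr(AC)·Tr(BD)) / (d(d² − 1)). -/
open MeasureTheory Matrix

/-- Matrices inherit the product measurable structure, so that the compact group
`U(d)` of `d×d` unitary matrices becomes a measurable space and one can speak of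
the Haar probability measure on it. -/
noncomputable instance matrixMeasurableSpace (m n R : Type*) [MeasurableSpace R] :
    MeasurableSpace (Matrix m n R) := MeasurableSpace.pi

instance matrixBorelSpace (m n R : Type*) [Countable m] [Countable n] [TopologicalSpace R]
    [MeasurableSpace R] [SecondCountableTopology R] [BorelSpace R] : BorelSpace (Matrix m n R) :=
  inferInstanceAs (BorelSpace (m → n → R))

section InvariantTensors

variable {n : Type*} [Fintype n] [DecidableEq n]

/-- A four-index tensor fixed by `U ⊗ conj U ⊗ U ⊗ conj U` for every unitary `U`. -/
def IsUnitaryInvariant (T : n → n → n → n → ℂ) : Prop :=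
  ∀ U ∈ Matrix.unitaryGroup n ℂ, ∀ i j k l,
    T i j k l = ∑ a, ∑ b, ∑ c, ∑ e, U i a * star (U j b) * (U k c * star (U l e)) * T a b c e

namespace IsUnitaryInvariant

variable {T : n → n → n → n → ℂ}

theorem diagonal_smul (hT : IsUnitaryInvariant T) (z : n → ℂ) (hz : ∀ p, z p * star (z p) = 1)
    (i j k l : n) : T i j k l = z i * star (z j) * (z k * star (z l)) * T i j k l := by
  have hU : Matrix.diagonal z ∈ Matrix.unitaryGroup n ℂ := by
    rw [Matrix.mem_unitaryGroup_iff, Matrix.star_eq_conjTranspose, Matrix.diagonal_conjTranspose,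
      Matrix.diagonal_mul_diagonal, ← Matrix.diagonal_one]
    congr 1
    funext p
    exact hz p
  have h := hT _ hU i j k l
  simpa [Matrix.diagonal_apply, apply_ite, ite_mul, mul_ite] using h

theorem eq_zero (hT : IsUnitaryInvariant T) {i j k l : n} (h₁ : ¬(i = j ∧ k = l))
    (h₂ : ¬(i = l ∧ k = j)) : T i j k l = 0 := by
  have key (q : n) := hT.diagonal_smul (fun p => if p = q then Complex.I else 1)
    (fun p => by split_ifs <;> simp) i j k l
  have hI {x : ℂ} (hx : x = Complex.I * x) : x = 0 := by
    have h : (1 : ℂ) - Complex.I ≠ 0 := fun h => by simpa using congrArg Complex.re h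
    exact (mul_eq_zero.mp (by linear_combination hx : (1 - Complex.I) * x = 0)).resolve_left h
  by_cases hij : i = j
  · subst hij
    have hlk : l ≠ k := fun h => h₁ ⟨rfl, h.symm⟩
    have h := key k
    refine hI ?_
    by_cases hik : i = k
    · subst hik
      simpa [hlk] using h
    · simpa [hik, hlk] using h
  · by_cases hil : i = l
    · subst hil
      have hjk : j ≠ k := fun h => h₂ ⟨rfl, h.symm⟩
      have h := key k
      refine hI ?_
      by_cases hik : i = k
      · subst hik
        simpa [hjk] using h
      · simpa [hik, hjk] using h
    · have h := key i
      by_cases hki : k = i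
      · subst hki
        exact self_eq_neg.mp (by simpa [Ne.symm hij, Ne.symm hil] using h)
      · exact hI (by simpa [hki, Ne.symm hij, Ne.symm hil] using h)

theorem perm (hT : IsUnitaryInvariant T) (σ : Equiv.Perm n) (i j k l : n) :
    T i j k l = T (σ i) (σ j) (σ k) (σ l) := by
  have hU : σ.permMatrix ℂ ∈ Matrix.unitaryGroup n ℂ := by
    rw [Matrix.mem_unitaryGroup_iff, Matrix.star_eq_conjTranspose, Matrix.conjTranspose_permMatrix,
      ← Matrix.permMatrix_mul]
    simp
  have h := hT _ hU i j k l
  simpa [Equiv.Perm.permMatrix, PEquiv.toMatrix_apply, apply_ite, ite_mul, mul_ite] using h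

/-- Obtained from invariance under the Householder reflection along `e p + 2 e q`. -/
theorem diag_eq (hT : IsUnitaryInvariant T) {p q : n} (hpq : p ≠ q) :
    T p p p p = T p p q q + T p q q p := by
  have hqp := hpq.symm
  let v : n → ℂ := Pi.single p 1 + Pi.single q 2
  let U : Matrix n n ℂ := 1 - (2 / 5 : ℂ) • Matrix.vecMulVec v v
  have hv (a : n) : star (v a) = v a := by
    simp only [v, Pi.add_apply, Pi.single_apply]
    split_ifs <;> simp
  have hstar : star v = v := funext hv
  have hdot : v ⬝ᵥ v = 5 := by
    simp [v, dotProduct_add, hpq, hqp]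
    norm_num
  have hUU : Uᴴ = U := by
    simp [U, Matrix.conjTranspose_vecMulVec, hstar]
  have hU : U ∈ Matrix.unitaryGroup n ℂ := by
    rw [Matrix.mem_unitaryGroup_iff, Matrix.star_eq_conjTranspose, hUU]
    have hP : Matrix.vecMulVec v v * Matrix.vecMulVec v v = (5 : ℂ) • Matrix.vecMulVec v v := by
      rw [Matrix.vecMulVec_mul_vecMulVec, hdot, Matrix.vecMulVec_smul]
    simp only [U, mul_sub, sub_mul, mul_one, one_mul, smul_mul_assoc, mul_smul_comm, hP]
    module
  have hs (a : n) : star (U p a) = U p a := by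
    simp only [U, Matrix.sub_apply, Matrix.smul_apply, Matrix.vecMulVec_apply, Matrix.one_apply,
      star_sub, star_smul, star_mul', hv]
    split_ifs <;> simp
  have hsum (f : n → ℂ) : ∑ a, U p a * f a = 3 / 5 * f p - 4 / 5 * f q := by
    simp [U, v, Matrix.one_apply, Matrix.vecMulVec_apply, Pi.single_apply, sub_mul, mul_add,
      add_mul, Finset.sum_add_distrib, hpq]
    ring
  have h := hT U hU p p p p
  have h₁ : T q q q q = T p p p p := by
    simpa using hT.perm (Equiv.swap p q) q q q q
  have h₂ : T q q p p = T p p q q := by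
    simpa using hT.perm (Equiv.swap p q) q q p p
  have h₃ : T q p p q = T p q q p := by
    simpa using hT.perm (Equiv.swap p q) q p p q
  have z (i j k l : n) := @eq_zero _ _ _ _ hT i j k l
  simp only [hs, mul_assoc, ← Finset.mul_sum, hsum, h₁, h₂, h₃] at h
  rw [z p p p q, z p p q p, z p q p p, z q p p p, z p q q q, z q p q q, z q q p q, z q q q p,
    z p q p q, z q p q p] at h <;> try simp [hpq, hqp]
  linear_combination 625 / 288 * h

theorem exists_eq [Nontrivial n] (hT : IsUnitaryInvariant T) : ∃ α β : ℂ, ∀ i j k l,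
    T i j k l = (if i = j ∧ k = l then α else 0) + (if i = l ∧ k = j then β else 0) := by
  obtain ⟨p, q, hpq⟩ := exists_pair_ne n
  refine ⟨T p p q q, T p q q p, fun i j k l => ?_⟩
  have hσ {i k : n} (hik : i ≠ k) : ∃ σ : Equiv.Perm n, σ i = p ∧ σ k = q :=
    MulAction.is_two_pretransitive_iff.mp (Equiv.Perm.isMultiplyPretransitive n 2) hik hpq
  by_cases h₁ : i = j ∧ k = l
  · obtain ⟨rfl, rfl⟩ := h₁
    by_cases hik : i = k
    · subst hik
      have h := hT.perm (Equiv.swap i p) i i i i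
      simp only [Equiv.swap_apply_left] at h
      simp [h, hT.diag_eq hpq]
    · obtain ⟨σ, rfl, rfl⟩ := hσ hik
      simp [hik, ← hT.perm σ]
  · by_cases h₂ : i = l ∧ k = j
    · obtain ⟨rfl, rfl⟩ := h₂
      have hik : i ≠ k := fun h => h₁ ⟨h, h.symm⟩
      obtain ⟨σ, rfl, rfl⟩ := hσ hik
      simp [hik, ← hT.perm σ]
    · simp [h₁, h₂, hT.eq_zero h₁ h₂]

end IsUnitaryInvariant

end InvariantTensors

section Moments

variable {n : Type*} [Fintype n]

theorem conjugate_apply (U X : Matrix n n ℂ) (i j : n) :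
    (U * X * Uᴴ) i j = ∑ a, ∑ b, U i a * star (U j b) * X a b := by
  simp only [Matrix.mul_apply, Matrix.conjTranspose_apply, Finset.sum_mul]
  rw [Finset.sum_comm]
  exact Finset.sum_congr rfl fun a _ => Finset.sum_congr rfl fun b _ => by ring

theorem trace_mul_mul_mul (M B N D : Matrix n n ℂ) :
    (M * B * N * D).trace = ∑ i, ∑ j, ∑ k, ∑ l, B j k * D l i * (M i j * N k l) := by
  simp only [Matrix.trace, Matrix.diag_apply, Matrix.mul_assoc, Matrix.mul_apply (M := M),
    Matrix.mul_apply (M := B), Matrix.mul_apply (M := N), Finset.mul_sum]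
  refine Finset.sum_congr rfl fun a _ => Finset.sum_congr rfl fun b _ =>
    Finset.sum_congr rfl fun c _ => Finset.sum_congr rfl fun e _ => ?_
  ring

variable [DecidableEq n]

theorem norm_conjugate_apply_le {U : Matrix n n ℂ} (hU : U ∈ Matrix.unitaryGroup n ℂ)
    (X : Matrix n n ℂ) (i j : n) : ‖(U * X * Uᴴ) i j‖ ≤ ∑ a, ∑ b, ‖X a b‖ := by
  rw [conjugate_apply]
  refine (norm_sum_le _ _).trans (Finset.sum_le_sum fun a _ =>
    (norm_sum_le _ _).trans (Finset.sum_le_sum fun b _ => ?_))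
  rw [norm_mul, norm_mul, norm_star]
  exact mul_le_of_le_one_left (norm_nonneg _) (mul_le_one₀ (entry_norm_bound_of_unitary hU _ _)
    (norm_nonneg _) (entry_norm_bound_of_unitary hU _ _))

variable (μ : Measure (Matrix.unitaryGroup n ℂ))

theorem integrable_conjugate_mul_conjugate [IsFiniteMeasure μ] (A C : Matrix n n ℂ)
    (i j k l : n) :
    Integrable (fun W : Matrix.unitaryGroup n ℂ =>
      ((W : Matrix n n ℂ) * A * (W : Matrix n n ℂ)ᴴ) i j *
        ((W : Matrix n n ℂ) * C * (W : Matrix n n ℂ)ᴴ) k l) μ := by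
  have hc (X : Matrix n n ℂ) (i j : n) : Continuous (fun W : Matrix.unitaryGroup n ℂ =>
      ((W : Matrix n n ℂ) * X * (W : Matrix n n ℂ)ᴴ) i j) := by
    refine Continuous.matrix_elem ?_ i j
    fun_prop
  refine Integrable.of_bound ((hc A i j).mul (hc C k l)).aestronglyMeasurable
    ((∑ a, ∑ b, ‖A a b‖) * ∑ a, ∑ b, ‖C a b‖) (Filter.Eventually.of_forall fun W => ?_)
  rw [norm_mul]
  exact mul_le_mul (norm_conjugate_apply_le W.2 A i j) (norm_conjugate_apply_le W.2 C k l)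
    (norm_nonneg _) (by positivity)

/-- The entries of `∫ (W A Wᴴ) ⊗ (W C Wᴴ) ∂μ`. -/
noncomputable def conjugateMoment (A C : Matrix n n ℂ) (i j k l : n) : ℂ :=
  ∫ W, ((W : Matrix n n ℂ) * A * (W : Matrix n n ℂ)ᴴ) i j *
    ((W : Matrix n n ℂ) * C * (W : Matrix n n ℂ)ᴴ) k l ∂μ

theorem isUnitaryInvariant_conjugateMoment [μ.IsMulLeftInvariant] [IsFiniteMeasure μ]
    (A C : Matrix n n ℂ) : IsUnitaryInvariant (conjugateMoment μ A C) := by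
  intro U hU i j k l
  have hint := integrable_conjugate_mul_conjugate μ A C
  unfold conjugateMoment
  simp only [← integral_const_mul]
  rw [← integral_mul_left_eq_self _ (⟨U, hU⟩ : Matrix.unitaryGroup n ℂ)]
  simp_rw [← integral_finsetSum Finset.univ fun e _ => (hint _ _ _ e).const_mul _]
  simp_rw [← integral_finsetSum Finset.univ fun c _ =>
    integrable_finsetSum Finset.univ fun e _ => (hint _ _ c e).const_mul _]
  simp_rw [← integral_finsetSum Finset.univ fun b _ => integrable_finsetSum Finset.univ fun c _ =>
    integrable_finsetSum Finset.univ fun e _ => (hint _ b c e).const_mul _]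
  rw [← integral_finsetSum Finset.univ fun a _ => integrable_finsetSum Finset.univ fun b _ =>
    integrable_finsetSum Finset.univ fun c _ =>
    integrable_finsetSum Finset.univ fun e _ => (hint a b c e).const_mul _]
  refine integral_congr_ae (Filter.Eventually.of_forall fun W => ?_)
  have hassoc (V X : Matrix n n ℂ) : U * V * X * (U * V)ᴴ = U * (V * X * Vᴴ) * Uᴴ := by
    simp only [Matrix.conjTranspose_mul, Matrix.mul_assoc]
  simp only [Submonoid.coe_mul, hassoc]
  rw [conjugate_apply U, conjugate_apply U]
  simp only [Finset.sum_mul]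
  simp only [Finset.mul_sum]
  refine Finset.sum_congr rfl fun a _ => Finset.sum_congr rfl fun b _ =>
    Finset.sum_congr rfl fun c _ => Finset.sum_congr rfl fun e _ => ?_
  ring

theorem integral_sum_sum_conjugate [IsFiniteMeasure μ] (A C : Matrix n n ℂ)
    (f : n → n → n → n → ℂ) :
    ∫ W, (∑ i, ∑ j, ∑ k, ∑ l, f i j k l * (((W : Matrix n n ℂ) * A * (W : Matrix n n ℂ)ᴴ) i j *
      ((W : Matrix n n ℂ) * C * (W : Matrix n n ℂ)ᴴ) k l)) ∂μ =
    ∑ i, ∑ j, ∑ k, ∑ l, f i j k l * conjugateMoment μ A C i j k l := by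
  have hint := integrable_conjugate_mul_conjugate μ A C
  unfold conjugateMoment
  simp only [← integral_const_mul]
  rw [integral_finsetSum Finset.univ fun a _ => integrable_finsetSum Finset.univ fun b _ =>
    integrable_finsetSum Finset.univ fun c _ =>
    integrable_finsetSum Finset.univ fun e _ => (hint a b c e).const_mul _]
  refine Finset.sum_congr rfl fun a _ => ?_
  rw [integral_finsetSum Finset.univ fun b _ => integrable_finsetSum Finset.univ fun c _ =>
    integrable_finsetSum Finset.univ fun e _ => (hint a b c e).const_mul _]
  refine Finset.sum_congr rfl fun b _ => ?_
  rw [integral_finsetSum Finset.univ fun c _ =>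
    integrable_finsetSum Finset.univ fun e _ => (hint a b c e).const_mul _]
  refine Finset.sum_congr rfl fun c _ => ?_
  rw [integral_finsetSum Finset.univ fun e _ => (hint a b c e).const_mul _]

/-- Integrals of tensor contractions of `(W A Wᴴ) ⊗ (W C Wᴴ)`, up to two constants. -/
theorem exists_integral_trace_eq [Nontrivial n] [μ.IsMulLeftInvariant] [IsFiniteMeasure μ]
    (A C : Matrix n n ℂ) : ∃ α β : ℂ, ∀ f : n → n → n → n → ℂ,
    ∫ W, (∑ i, ∑ j, ∑ k, ∑ l, f i j k l * (((W : Matrix n n ℂ) * A * (W : Matrix n n ℂ)ᴴ) i j *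
      ((W : Matrix n n ℂ) * C * (W : Matrix n n ℂ)ᴴ) k l)) ∂μ =
    α * (∑ i, ∑ k, f i i k k) + β * ∑ i, ∑ k, f i k k i := by
  obtain ⟨α, β, h⟩ := (isUnitaryInvariant_conjugateMoment μ A C).exists_eq
  refine ⟨α, β, fun f => ?_⟩
  rw [integral_sum_sum_conjugate]
  simp only [h, mul_add, Finset.sum_add_distrib, ite_and, mul_ite, mul_zero, Finset.mul_sum]
  congr 1
  · refine Finset.sum_congr rfl fun i _ => ?_
    rw [Finset.sum_eq_single i] <;> simp +contextual [mul_comm, eq_comm]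
  · refine Finset.sum_congr rfl fun i _ => ?_
    refine Finset.sum_congr rfl fun j _ => ?_
    rw [Finset.sum_eq_single j] <;> simp +contextual [mul_comm, eq_comm]

end Moments

/-- Proposition 2 of the paper: the second-moment Haar integration
formula over the unitary group, single trace form. -/
theorem stmt5 (d : ℕ) (hd : 2 ≤ d) (A B C D : Matrix (Fin d) (Fin d) ℂ)
    (μ : Measure (Matrix.unitaryGroup (Fin d) ℂ))
    [μ.IsHaarMeasure] [IsProbabilityMeasure μ] :
    (∫ W, ((W : Matrix (Fin d) (Fin d) ℂ) * A * (W : Matrix (Fin d) (Fin d) ℂ)ᴴ * B *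
        (W : Matrix (Fin d) (Fin d) ℂ) * C * (W : Matrix (Fin d) (Fin d) ℂ)ᴴ * D).trace ∂μ) =
      ((A * C).trace * B.trace * D.trace + A.trace * C.trace * (B * D).trace) /
          ((d : ℂ) ^ 2 - 1) -
        (A.trace * B.trace * C.trace * D.trace + (A * C).trace * (B * D).trace) /
          ((d : ℂ) * ((d : ℂ) ^ 2 - 1)) := by
  have : NeZero d := ⟨by lia⟩
  have : Nontrivial (Fin d) := Fin.nontrivial_iff_two_le.mpr hd
  obtain ⟨α, β, h⟩ := exists_integral_trace_eq μ A C
  have hUU (W : Matrix.unitaryGroup (Fin d) ℂ) :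
      (W : Matrix (Fin d) (Fin d) ℂ)ᴴ * (W : Matrix (Fin d) (Fin d) ℂ) = 1 :=
    Matrix.mem_unitaryGroup_iff'.mp W.2
  have htr (W : Matrix.unitaryGroup (Fin d) ℂ) (X : Matrix (Fin d) (Fin d) ℂ) :
      ((W : Matrix (Fin d) (Fin d) ℂ) * X * (W : Matrix (Fin d) (Fin d) ℂ)ᴴ).trace = X.trace := by
    rw [Matrix.trace_mul_comm, ← Matrix.mul_assoc, hUU, Matrix.one_mul]
  have hAC : A.trace * C.trace = α * (d : ℂ) ^ 2 + β * d := by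
    have hf (M N : Matrix (Fin d) (Fin d) ℂ) :
        ∑ i, ∑ j, ∑ k, ∑ l, (if i = j then 1 else 0) * (if k = l then 1 else 0) * (M i j * N k l) =
          M.trace * N.trace := by
      simp [Matrix.trace, Finset.sum_mul_sum]
    have h₁ := h fun i j k l => (if i = j then 1 else 0) * (if k = l then 1 else 0)
    simp only [hf, htr] at h₁
    simpa [sq] using h₁
  have hAC' : (A * C).trace = α * d + β * (d : ℂ) ^ 2 := by
    have h₁ := h fun i j k l => (1 : Matrix (Fin d) (Fin d) ℂ) j k *
      (1 : Matrix (Fin d) (Fin d) ℂ) l i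
    have hmul (W : Matrix.unitaryGroup (Fin d) ℂ) :
        (W : Matrix (Fin d) (Fin d) ℂ) * A * (W : Matrix (Fin d) (Fin d) ℂ)ᴴ *
          ((W : Matrix (Fin d) (Fin d) ℂ) * C * (W : Matrix (Fin d) (Fin d) ℂ)ᴴ) =
        (W : Matrix (Fin d) (Fin d) ℂ) * (A * C) * (W : Matrix (Fin d) (Fin d) ℂ)ᴴ := by
      simp only [← Matrix.mul_assoc]
      rw [Matrix.mul_assoc _ _ (W : Matrix (Fin d) (Fin d) ℂ), hUU, Matrix.mul_one]
    simp only [← trace_mul_mul_mul, Matrix.mul_one, hmul, htr] at h₁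
    simpa [Matrix.one_apply, sq] using h₁
  have hBD : (∑ i, ∑ k, B i k * D k i) = (B * D).trace := by
    simp [Matrix.trace, Matrix.mul_apply]
  have hBD' : (∑ i, ∑ k, B k k * D i i) = B.trace * D.trace := by
    simp only [Matrix.trace, Matrix.diag_apply, Finset.sum_mul_sum]
    exact Finset.sum_comm
  have hd₀ : (d : ℂ) ≠ 0 := by exact_mod_cast NeZero.ne d
  have hd₁ : (d : ℂ) ^ 2 - 1 ≠ 0 := by
    have : (d : ℤ) ^ 2 - 1 ≠ 0 := by nlinarith
    exact_mod_cast this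
  have hmain := h fun i j k l => B j k * D l i
  simp only [← trace_mul_mul_mul] at hmain
  simp only [← Matrix.mul_assoc] at hmain
  rw [hmain, hBD, hBD', hAC']
  field_simp
  linear_combination (B.trace * D.trace - d * (B * D).trace) * hAC
end

section
/- Let U and V be d×d unitary matrices, let ψ_j and ψ_k be vectors in ℂ^d, and let c_j, c_k be complex numbers of modulus 1 such that U·ψ_j = c_j·(V·ψ_j) and U·ψ_k = c_k·(V·ψ_k). If ⟨ψ_k, ψ_j⟩ ≠ 0, then c_j = c_k. -/
open Matrix

/-- A unitary matrix preserves the standard Hermitian product. -/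
theorem star_mulVec_dotProduct_mulVec_of_mem_unitaryGroup {n R : Type*} [Fintype n]
    [DecidableEq n] [CommRing R] [StarRing R] {A : Matrix n n R}
    (hA : A ∈ Matrix.unitaryGroup n R) (x y : n → R) :
    star (A *ᵥ x) ⬝ᵥ (A *ᵥ y) = star x ⬝ᵥ y := by
  rw [star_mulVec, ← dotProduct_mulVec, mulVec_mulVec, ← star_eq_conjTranspose,
    Matrix.mem_unitaryGroup_iff'.mp hA, one_mulVec]

/-- phase alignment, Eqn. (26) of the paper: if `U ψ_j = c_j (V ψ_j)` and
`U ψ_k = c_k (V ψ_k)` for unitaries `U, V` and unimodular scalars `c_j, c_k`, and if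
`⟨ψ_k, ψ_j⟩ ≠ 0`, then `c_j = c_k`. -/
theorem stmt8 (d : ℕ) (U V : Matrix (Fin d) (Fin d) ℂ)
    (hU : U ∈ Matrix.unitaryGroup (Fin d) ℂ)
    (hV : V ∈ Matrix.unitaryGroup (Fin d) ℂ)
    (ψj ψk : Fin d → ℂ) (cj ck : ℂ) (hcj : ‖cj‖ = 1) (hck : ‖ck‖ = 1)
    (hj : U *ᵥ ψj = cj • (V *ᵥ ψj)) (hk : U *ᵥ ψk = ck • (V *ᵥ ψk))
    (hne : star ψk ⬝ᵥ ψj ≠ 0) : cj = ck := by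
  have hprod : star ck * cj = 1 := by
    have h := star_mulVec_dotProduct_mulVec_of_mem_unitaryGroup hU ψk ψj
    rw [hj, hk, star_smul, smul_dotProduct, dotProduct_smul,
      star_mulVec_dotProduct_mulVec_of_mem_unitaryGroup hV, smul_smul, smul_eq_mul] at h
    exact mul_right_cancel₀ hne (h.trans (one_mul _).symm)
  have hck' : ck * star ck = 1 := by
    simpa [hck] using Complex.mul_conj' ck
  calc cj = ck * star ck * cj := by rw [hck', one_mul]
    _ = ck := by rw [mul_assoc, hprod, mul_one]
end

section
/- Let N ≥ 1, m ≥ 1, d = N + m, let O be a d×d Hermitian complex matrix written in block form O = fromBlocks(A, B, C, D) with A of size N×N and D of size m×m, and let P be an N×N diagonal unitary matrix. Then ∫ Tr( O · fromBlocks(P, 0, 0, Y) · O · fromBlocks(P, 0, 0, Y)† ) dHaar_m(Y) = Tr(A·P·A·P†) + (Tr D)² / m, where the integral is over the Haar probability measure on the group of m×m unitary matrices. -/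
open MeasureTheory Matrix

namespace Matrix

theorem trace_fromBlocks_mul_diag_mul_conjTranspose {k l : Type*} [Fintype k] [Fintype l]
    (A : Matrix k k ℂ) (B : Matrix k l ℂ) (C : Matrix l k ℂ) (D : Matrix l l ℂ)
    (P : Matrix k k ℂ) (Y : Matrix l l ℂ) :
    (fromBlocks A B C D * fromBlocks P 0 0 Y * fromBlocks A B C D *
        (fromBlocks P 0 0 Y)ᴴ).trace =
      (A * P * A * Pᴴ).trace + ((B * Y * C * Pᴴ).trace + (C * P * B * Yᴴ).trace +
        (D * (Y * D * Yᴴ)).trace) := by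
  simp only [fromBlocks_conjTranspose, fromBlocks_multiply, conjTranspose_zero, Matrix.mul_zero,
    add_zero, zero_add]
  simp only [trace, diag_apply, Fintype.sum_sum_type, fromBlocks_apply₁₁, fromBlocks_apply₂₂,
    Matrix.add_mul, add_apply, Finset.sum_add_distrib, Matrix.mul_assoc]
  ring

variable {n : Type*} [Fintype n] [DecidableEq n]

instance compactSpace_unitaryGroup : CompactSpace (unitaryGroup n ℂ) := by
  refine isCompact_iff_compactSpace.mp (IsCompact.of_isClosed_subset
    (isCompact_univ_pi fun _ : n => isCompact_univ_pi fun _ : n =>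
      isCompact_closedBall (0 : ℂ) 1) isClosed_unitary ?_)
  intro U hU i _ j _
  simpa using entry_norm_bound_of_unitary hU i j

/-- The unitary matrices span all complex matrices, so commuting with them is commuting with
everything. -/
theorem commute_of_forall_mem_unitaryGroup {M : Matrix n n ℂ}
    (h : ∀ U ∈ unitaryGroup n ℂ, Commute U M) (Q : Matrix n n ℂ) : Commute Q M := by
  open scoped Matrix.Norms.L2Operator in
  have hspan := CStarAlgebra.span_unitary (Matrix n n ℂ)
  have hQ : Q ∈ Submodule.span ℂ (unitaryGroup n ℂ : Set (Matrix n n ℂ)) := by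
    rw [hspan]
    trivial
  induction hQ using Submodule.span_induction with
  | mem U hU => exact h U hU
  | zero => exact Commute.zero_left _
  | add _ _ _ _ hx hy => exact hx.add_left hy
  | smul a _ _ hx => exact hx.smul_left a

theorem exists_eq_scalar_of_commute_unitaryGroup {M : Matrix n n ℂ}
    (h : ∀ U ∈ unitaryGroup n ℂ, Commute U M) : ∃ c, scalar n c = M :=
  mem_range_scalar_iff_commute_single.mpr fun _ _ _ => commute_of_forall_mem_unitaryGroup h _

theorem integral_mul_mul_apply {X : Type*} [MeasurableSpace X] {μ : Measure X}
    {k l m : Type*} [Fintype k] [Fintype l] {p : Type*} {f : X → Matrix k l ℂ}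
    (hf : ∀ i j, Integrable (fun x => f x i j) μ) (Q : Matrix m k ℂ) (R : Matrix l p ℂ)
    (i : m) (j : p) :
    ∫ x, (Q * f x * R) i j ∂μ = (Q * (of fun a b => ∫ x, f x a b ∂μ) * R) i j := by
  have hQ : ∀ b, Integrable (fun x => ∑ a, Q i a * f x a b) μ := fun b =>
    integrable_finsetSum _ fun a _ => (hf a b).const_mul _
  simp only [mul_apply, of_apply]
  rw [integral_finsetSum _ fun b _ => (hQ b).mul_const _]
  refine Finset.sum_congr rfl fun b _ => ?_
  rw [integral_mul_const, integral_finsetSum _ fun a _ => (hf a b).const_mul _]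
  simp only [integral_const_mul]

variable {μ : Measure (unitaryGroup n ℂ)}

theorem integrable_of_continuous_unitaryGroup [IsFiniteMeasure μ] {f : unitaryGroup n ℂ → ℂ}
    (hf : Continuous f) : Integrable f μ :=
  hf.integrable_of_hasCompactSupport (HasCompactSupport.of_compactSpace f)

theorem continuous_conj_unitaryGroup (D : Matrix n n ℂ) :
    Continuous fun Y : unitaryGroup n ℂ => (Y : Matrix n n ℂ) * D * (Y : Matrix n n ℂ)ᴴ :=
  (continuous_subtype_val.matrix_mul continuous_const).matrix_mul
    continuous_subtype_val.matrix_conjTranspose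

/-- The Haar average of `Y * D * Yᴴ` is the scalar matrix with the same trace as `D`. -/
theorem integral_conj_unitaryGroup [Nonempty n] [μ.IsMulLeftInvariant] [IsProbabilityMeasure μ]
    (D : Matrix n n ℂ) :
    (of fun i j => ∫ Y, ((Y : Matrix n n ℂ) * D * (Y : Matrix n n ℂ)ᴴ) i j ∂μ) =
      scalar n (D.trace / Fintype.card n) := by
  have hint : ∀ i j, Integrable
      (fun Y : unitaryGroup n ℂ => ((Y : Matrix n n ℂ) * D * (Y : Matrix n n ℂ)ᴴ) i j) μ :=
    fun i j => integrable_of_continuous_unitaryGroup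
      ((continuous_conj_unitaryGroup D).matrix_elem i j)
  set M : Matrix n n ℂ :=
    of fun i j => ∫ Y, ((Y : Matrix n n ℂ) * D * (Y : Matrix n n ℂ)ᴴ) i j ∂μ with hM
  have hconj : ∀ U ∈ unitaryGroup n ℂ, U * M * Uᴴ = M := by
    intro U hU
    ext i j
    rw [hM, ← integral_mul_mul_apply hint, of_apply]
    refine Eq.trans ?_ (integral_mul_left_eq_self _ (⟨U, hU⟩ : unitaryGroup n ℂ))
    simp only [Submonoid.coe_mul, conjTranspose_mul, Matrix.mul_assoc]
  obtain ⟨c, hc⟩ := exists_eq_scalar_of_commute_unitaryGroup (M := M) fun U hU => by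
    have h : Uᴴ * U = 1 := mem_unitaryGroup_iff'.mp hU
    calc U * M = U * M * (Uᴴ * U) := by rw [h, Matrix.mul_one]
      _ = U * M * Uᴴ * U := by simp only [Matrix.mul_assoc]
      _ = M * U := by rw [hconj U hU]
  have htrace : M.trace = D.trace := by
    simp only [trace, diag_apply, hM, of_apply]
    rw [← integral_finsetSum _ fun i _ => hint i i]
    have h : ∀ Y : unitaryGroup n ℂ,
        ∑ i, ((Y : Matrix n n ℂ) * D * (Y : Matrix n n ℂ)ᴴ) i i = ∑ i, D i i := fun Y => by
      change trace _ = trace _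
      have hY : (Y : Matrix n n ℂ)ᴴ * Y = 1 := mem_unitaryGroup_iff'.mp Y.2
      rw [trace_mul_comm, ← Matrix.mul_assoc, hY, Matrix.one_mul]
    simp [h]
  have hcard : (Fintype.card n : ℂ) ≠ 0 := Nat.cast_ne_zero.mpr Fintype.card_ne_zero
  rw [← hc] at htrace ⊢
  rw [← htrace]
  simp [trace, hcard]

theorem integral_trace_mul_conj_unitaryGroup [Nonempty n] [μ.IsMulLeftInvariant]
    [IsProbabilityMeasure μ] (Q D : Matrix n n ℂ) :
    ∫ Y, (Q * ((Y : Matrix n n ℂ) * D * (Y : Matrix n n ℂ)ᴴ)).trace ∂μ =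
      Q.trace * D.trace / Fintype.card n := by
  have hcont := continuous_conj_unitaryGroup D
  have h := fun i => integral_mul_mul_apply (μ := μ) (fun i j =>
    integrable_of_continuous_unitaryGroup (hcont.matrix_elem i j)) Q (1 : Matrix n n ℂ) i i
  simp only [Matrix.mul_one, integral_conj_unitaryGroup] at h
  simp only [trace, diag_apply]
  rw [integral_finsetSum _ fun i _ => integrable_of_continuous_unitaryGroup
    ((continuous_const.matrix_mul hcont).matrix_elem i i), Finset.sum_congr rfl fun i _ => h i]
  simp only [scalar_apply, mul_diagonal, trace, diag_apply, ← Finset.sum_mul, mul_div_assoc]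

end Matrix

/-- Eqn. (F2) in the proof of Theorem 3: for a Hermitian block matrix
`O = fromBlocks A B C D` on `ℂ^N ⊕ ℂ^m` and a diagonal unitary `P` of size `N`,
`∫ Tr(O·(P ⊕ Y)·O·(P ⊕ Y)†) dHaar_m(Y) = Tr(A P A P†) + (Tr D)²/m`. -/
theorem stmt13 (N m : ℕ) (hN : 1 ≤ N) (hm : 1 ≤ m) (d : ℕ) (hd : d = N + m)
    (A : Matrix (Fin N) (Fin N) ℂ) (B : Matrix (Fin N) (Fin m) ℂ)
    (C : Matrix (Fin m) (Fin N) ℂ) (D : Matrix (Fin m) (Fin m) ℂ)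
    (hO : (Matrix.fromBlocks A B C D).IsHermitian)
    (P : Matrix (Fin N) (Fin N) ℂ)
    (hPu : P ∈ Matrix.unitaryGroup (Fin N) ℂ) (hPdiag : P.IsDiag)
    (μ : Measure (Matrix.unitaryGroup (Fin m) ℂ))
    [μ.IsHaarMeasure] [IsProbabilityMeasure μ] :
    (∫ Y, (Matrix.fromBlocks A B C D *
          Matrix.fromBlocks P 0 0 (Y : Matrix (Fin m) (Fin m) ℂ) *
          Matrix.fromBlocks A B C D *
          (Matrix.fromBlocks P 0 0 (Y : Matrix (Fin m) (Fin m) ℂ))ᴴ).trace ∂μ) =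
      (A * P * A * Pᴴ).trace + D.trace ^ 2 / (m : ℂ) := by
  have : Nonempty (Fin m) := ⟨⟨0, hm⟩⟩
  have hlin : Integrable (fun Y : unitaryGroup (Fin m) ℂ =>
      (B * (Y : Matrix (Fin m) (Fin m) ℂ) * C * Pᴴ).trace +
        (C * P * B * (Y : Matrix (Fin m) (Fin m) ℂ)ᴴ).trace) μ :=
    integrable_of_continuous_unitaryGroup (by fun_prop)
  have hquad : Integrable (fun Y : unitaryGroup (Fin m) ℂ => (D * ((Y : Matrix (Fin m) (Fin m) ℂ) *
      D * (Y : Matrix (Fin m) (Fin m) ℂ)ᴴ)).trace) μ :=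
    integrable_of_continuous_unitaryGroup (by fun_prop)
  have hzero : ∫ Y, ((B * (Y : Matrix (Fin m) (Fin m) ℂ) * C * Pᴴ).trace +
      (C * P * B * (Y : Matrix (Fin m) (Fin m) ℂ)ᴴ).trace) ∂μ = 0 := by
    refine integral_eq_zero_of_mul_left_eq_neg (g := (-1 : unitaryGroup (Fin m) ℂ)) fun Y => ?_
    rw [neg_one_mul, Unitary.coe_neg]
    simp only [conjTranspose_neg, Matrix.mul_neg, Matrix.neg_mul, trace_neg]
    ring
  simp only [trace_fromBlocks_mul_diag_mul_conjTranspose]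
  have hconst : Integrable (fun _ : unitaryGroup (Fin m) ℂ => (A * P * A * Pᴴ).trace) μ :=
    integrable_const _
  refine (integral_add hconst (hlin.add hquad)).trans ?_
  rw [integral_add' hlin hquad, hzero, integral_trace_mul_conj_unitaryGroup]
  simp [sq]
end

section
/- Let d ≥ 2, let 1 ≤ N < d, let m = d − N, and let O be a d×d Hermitian complex matrix. For a unitary Y ∈ U(m), set W(Y) = fromBlocks(I_N, 0, 0, Y), where I_N is the N×N identity. Then ∫_{U(d)} ∫_{U(m)} Tr( U†·O·U · W(Y)† · U†·O·U · W(Y) ) dHaar_m(Y) dHaar_d(U) = ( d·N²·Tr(O²) + (d² − N² − 1)·(Tr O)² ) / ( d(d² − 1) ). -/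
open MeasureTheory Matrix

namespace HaarMoments

open Complex

theorem exists_perm_pair {n : Type*} [DecidableEq n] {i j k l : n} (hij : i ≠ j) (hkl : k ≠ l) :
    ∃ σ : Equiv.Perm n, σ i = k ∧ σ j = l := by
  refine ⟨(Equiv.swap i k).trans (Equiv.swap (Equiv.swap i k j) l), ?_, by simp⟩
  have : k ≠ Equiv.swap i k j := fun h => hij <| by
    simpa using congrArg (Equiv.swap i k) h
  simp [Equiv.swap_apply_of_ne_of_ne this hkl]

section Invariance

variable {n : Type*} [Fintype n] [DecidableEq n] {Ω : Type*} [MeasurableSpace Ω]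

/-- A random matrix with integrable first and second moments whose law is invariant under
conjugation by unitaries. -/
structure ConjInvariant (μ : Measure Ω) (A : Ω → Matrix n n ℂ) : Prop where
  integrable_apply : ∀ i j, Integrable (fun ω => A ω i j) μ
  integrable_mul : ∀ i j k l, Integrable (fun ω => A ω i j * A ω k l) μ
  integral_conj : ∀ V ∈ unitaryGroup n ℂ, ∀ f : Matrix n n ℂ → ℂ,
    ∫ ω, f (Vᴴ * A ω * V) ∂μ = ∫ ω, f (A ω) ∂μ

variable {μ : Measure Ω} {A : Ω → Matrix n n ℂ}

theorem ConjInvariant.integral_perm (h : ConjInvariant μ A) (σ : Equiv.Perm n)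
    (f : Matrix n n ℂ → ℂ) :
    ∫ ω, f ((A ω).submatrix σ σ) ∂μ = ∫ ω, f (A ω) ∂μ := by
  have key : ∀ B : Matrix n n ℂ,
      ((σ⁻¹).permMatrix ℂ)ᴴ * B * (σ⁻¹).permMatrix ℂ = B.submatrix σ σ := by
    intro B
    rw [conjTranspose_permMatrix, inv_inv, PEquiv.toMatrix_toPEquiv_mul,
      PEquiv.mul_toMatrix_toPEquiv]
    ext i j
    simp [← Equiv.Perm.inv_def]
  rw [← h.integral_conj ((σ⁻¹).permMatrix ℂ) _ f]
  · simp_rw [key]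
  · rw [mem_unitaryGroup_iff, star_eq_conjTranspose, conjTranspose_permMatrix, ← permMatrix_mul]
    simp

theorem ConjInvariant.integral_phase (h : ConjInvariant μ A) (z : n → ℂ)
    (hz : ∀ i, z i * star (z i) = 1) (f : Matrix n n ℂ → ℂ) :
    ∫ ω, f (of fun i j => star (z i) * A ω i j * z j) ∂μ = ∫ ω, f (A ω) ∂μ := by
  rw [← h.integral_conj (diagonal z) _ f]
  · congr! with ω
    ext i j
    simp [diagonal_conjTranspose]
  · rw [mem_unitaryGroup_iff, star_eq_conjTranspose, diagonal_conjTranspose, diagonal_mul_diagonal]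
    simp only [Pi.star_apply, hz, diagonal_one]

/-- The moments of `A` weighted by a nontrivial phase character vanish. -/
theorem ConjInvariant.integral_eq_zero_of_phase (h : ConjInvariant μ A) (i : n) (z c : ℂ)
    (hz : z * star z = 1) (hc : c ≠ 1) (f : Matrix n n ℂ → ℂ)
    (hf : ∀ B : Matrix n n ℂ, f (of fun k l => star ((Pi.mulSingle i z : n → ℂ) k) * B k l *
      (Pi.mulSingle i z : n → ℂ) l) = c * f B) :
    ∫ ω, f (A ω) ∂μ = 0 := by
  have := h.integral_phase (Pi.mulSingle i z) (fun k => by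
    rcases eq_or_ne k i with rfl | hk <;> simp_all) f
  simp_rw [hf, integral_const_mul] at this
  have h2 : (c - 1) * ∫ ω, f (A ω) ∂μ = 0 := by linear_combination this
  exact (mul_eq_zero.mp h2).resolve_left (sub_ne_zero.mpr hc)

theorem ConjInvariant.integral_apply_of_ne (h : ConjInvariant μ A) {i j : n} (hij : i ≠ j) :
    ∫ ω, A ω i j ∂μ = 0 :=
  h.integral_eq_zero_of_phase i (-1) (-1) (by simp) (by norm_num) (fun B => B i j)
    fun B => by simp [hij.symm]

theorem ConjInvariant.integral_apply_self (h : ConjInvariant μ A) (i j : n) :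
    ∫ ω, A ω i i ∂μ = ∫ ω, A ω j j ∂μ := by
  simpa using h.integral_perm (Equiv.swap i j) (fun B => B j j)

theorem ConjInvariant.integral_apply [Nonempty n] (h : ConjInvariant μ A) (t : ℂ)
    (ht : ∫ ω, (A ω).trace ∂μ = t) (i j : n) :
    ∫ ω, A ω i j ∂μ = if i = j then t / Fintype.card n else 0 := by
  split_ifs with hij
  · subst hij
    simp only [trace, diag_apply] at ht
    rw [integral_finsetSum _ fun k _ => h.integrable_apply k k] at ht
    simp_rw [fun k => h.integral_apply_self k i] at ht
    rw [← ht]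
    simp
  · exact h.integral_apply_of_ne hij

theorem exists_unitary_mixing {i j : n} (hij : i ≠ j) :
    ∃ V ∈ unitaryGroup n ℂ, ∀ B : Matrix n n ℂ,
      (Vᴴ * B * V) i i = (B i i + B j j + I * (B i j - B j i)) / 2 := by
  set P : Matrix n n ℂ := single i i (1 / 2) + single i j (1 / 2) + single j i (1 / 2) +
    single j j (1 / 2) with hP
  have hPP : P * P = P := by
    ext a b
    simp only [hP, add_mul, mul_add, single_mul_single_same, single_mul_single_of_ne _ _ _ _ hij,
      single_mul_single_of_ne _ _ _ _ hij.symm, Matrix.add_apply, single_apply, Matrix.zero_apply]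
    split_ifs <;> norm_num
  have hPs : Pᴴ = P := by
    simp [hP, conjTranspose_add, conjTranspose_single]
    abel
  clear_value P
  have hV : (1 + (I - 1) • P)ᴴ = 1 + (-I - 1) • P := by
    simp [conjTranspose_add, conjTranspose_smul, hPs]
  refine ⟨1 + (I - 1) • P, ?_, fun B => ?_⟩
  · rw [mem_unitaryGroup_iff, star_eq_conjTranspose, hV]
    simp only [add_mul, mul_add, one_mul, mul_one, smul_mul_assoc, mul_smul_comm, hPP]
    match_scalars
    · norm_num
    · linear_combination -I_mul_I
  · have hcol : ∀ k, (1 + (I - 1) • P) k i =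
        (if k = i then (1 + I) / 2 else 0) + (if k = j then (I - 1) / 2 else 0) := by
      intro k
      subst hP
      rcases eq_or_ne k i with rfl | h1
      · simp [hij, hij.symm]
        ring
      · rcases eq_or_ne k j with rfl | h2
        · simp [hij, hij.symm]
          ring
        · simp [h1, h2, h1.symm, h2.symm]
    simp only [mul_apply, conjTranspose_apply, hcol, mul_add, add_mul, Finset.sum_add_distrib,
      star_add, apply_ite star, star_zero, ite_mul, mul_ite, mul_zero, zero_mul,
      Finset.sum_ite_eq', Finset.mem_univ, if_true]
    simp only [star_div₀, star_add, star_sub, star_one, Complex.star_def, conj_I, map_ofNat]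
    linear_combination (-(1 / 4) * (B i i + B i j + B j i + B j j)) * I_mul_I

theorem ConjInvariant.integral_mixing (h : ConjInvariant μ A) {i j : n} (hij : i ≠ j) :
    ∫ ω, A ω i i * A ω i i ∂μ =
      (∫ ω, A ω i i * A ω j j ∂μ) + ∫ ω, A ω i j * A ω j i ∂μ := by
  obtain ⟨V, hV, hVB⟩ := exists_unitary_mixing hij
  have h1 := h.integral_conj V hV (fun B => B i i * B i i)
  simp only [hVB] at h1
  have hji := hij.symm
  have off : ∀ {a b k : n}, a ≠ b → ∫ ω, A ω a b * A ω k k ∂μ = 0 := fun {a b k} hab =>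
    h.integral_eq_zero_of_phase a (-1) (-1) (by simp) (by norm_num) (fun B => B a b * B k k)
      fun B => by
        rcases eq_or_ne k a with rfl | hk <;> simp_all [hab.symm]
  have sq : ∀ {a b : n}, a ≠ b → ∫ ω, A ω a b * A ω a b ∂μ = 0 := fun {a b} hab =>
    h.integral_eq_zero_of_phase a I (-1) (by simp) (by norm_num) (fun B => B a b * B a b)
      fun B => by
        simp [hab.symm]
        linear_combination (B a b) ^ 2 * I_mul_I
  have hd : ∫ ω, A ω j j * A ω j j ∂μ = ∫ ω, A ω i i * A ω i i ∂μ := by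
    simpa using h.integral_perm (Equiv.swap i j) (fun B => B i i * B i i)
  have expand : ∀ ω, (A ω i i + A ω j j + I * (A ω i j - A ω j i)) / 2 *
      ((A ω i i + A ω j j + I * (A ω i j - A ω j i)) / 2) =
      (1 / 4) * (A ω i i * A ω i i) + (1 / 4) * (A ω j j * A ω j j)
        + (1 / 2) * (A ω i i * A ω j j) + (1 / 2) * (A ω i j * A ω j i)
        + (-1 / 4) * (A ω i j * A ω i j) + (-1 / 4) * (A ω j i * A ω j i)
        + (I / 2) * (A ω i j * A ω i i) + (I / 2) * (A ω i j * A ω j j)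
        + (-I / 2) * (A ω j i * A ω i i) + (-I / 2) * (A ω j i * A ω j j) := fun ω => by
    linear_combination ((A ω i j - A ω j i) ^ 2 / 4) * I_mul_I
  simp_rw [expand] at h1
  have hi := fun (c : ℂ) a b k l => (h.integrable_mul a b k l).const_mul c
  rw [integral_add, integral_add, integral_add, integral_add, integral_add, integral_add,
    integral_add, integral_add, integral_add] at h1
  · simp only [integral_const_mul, off hij, off hji, sq hij, sq hji, hd] at h1
    linear_combination -2 * h1
  all_goals
    repeat' first
      | exact hi _ _ _ _ _
      | apply Integrable.fun_add

theorem ConjInvariant.exists_integral_mul (h : ConjInvariant μ A) [Nontrivial n] :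
    ∃ q r : ℂ, ∀ i j,
      (∫ ω, A ω i i * A ω j j ∂μ = q + if i = j then r else 0) ∧
      (∫ ω, A ω i j * A ω j i ∂μ = r + if i = j then q else 0) := by
  obtain ⟨k, l, hkl⟩ := exists_pair_ne n
  refine ⟨∫ ω, A ω k k * A ω l l ∂μ, ∫ ω, A ω k l * A ω l k ∂μ, fun i j => ?_⟩
  rcases eq_or_ne i j with rfl | hij
  · have hd : ∫ ω, A ω i i * A ω i i ∂μ = ∫ ω, A ω k k * A ω k k ∂μ := by
      simpa using h.integral_perm (Equiv.swap i k) (fun B => B k k * B k k)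
    simp only [if_true, hd, h.integral_mixing hkl, add_comm, and_self]
  · obtain ⟨σ, rfl, rfl⟩ := exists_perm_pair hkl hij
    simp only [if_neg hij, add_zero]
    exact ⟨h.integral_perm σ (fun B => B k k * B l l), h.integral_perm σ (fun B => B k l * B l k)⟩

/-- The second moments of a conjugation-invariant random matrix `A` are determined by the values
of `tr A` and `tr A²`. -/
theorem ConjInvariant.integral_mul [IsProbabilityMeasure μ] (h : ConjInvariant μ A) [Nontrivial n]
    {s t d : ℂ} (ht : ∀ ω, (A ω).trace = t) (hs : ∀ ω, (A ω * A ω).trace = s)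
    (hd : (Fintype.card n : ℂ) = d) (i j : n) :
    (∫ ω, A ω i i * A ω j j ∂μ = (d * t ^ 2 - s) / (d * (d ^ 2 - 1)) +
      if i = j then (d * s - t ^ 2) / (d * (d ^ 2 - 1)) else 0) ∧
    (∫ ω, A ω i j * A ω j i ∂μ = (d * s - t ^ 2) / (d * (d ^ 2 - 1)) +
      if i = j then (d * t ^ 2 - s) / (d * (d ^ 2 - 1)) else 0) := by
  obtain ⟨q, r, hqr⟩ := h.exists_integral_mul
  have hcard : 1 < Fintype.card n := Fintype.one_lt_card
  have hd0 : d ≠ 0 := by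
    rw [← hd]
    exact_mod_cast (by lia : Fintype.card n ≠ 0)
  have hd1 : d ^ 2 - 1 ≠ 0 := by
    rw [← hd, sub_ne_zero]
    exact_mod_cast (Nat.one_lt_pow two_ne_zero hcard).ne'
  have h1 : t ^ 2 = d ^ 2 * q + d * r := by
    have : ∫ ω, (∑ i, A ω i i) * (∑ j, A ω j j) ∂μ = t ^ 2 := by
      simp only [trace, diag_apply] at ht
      simp [ht, sq]
    rw [← this]
    simp_rw [Finset.sum_mul_sum]
    rw [integral_finsetSum _ fun i _ => integrable_finsetSum _ fun j _ => h.integrable_mul i i j j]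
    simp_rw [fun i => integral_finsetSum Finset.univ
      fun j (_ : j ∈ Finset.univ) => h.integrable_mul i i j j, fun i j => (hqr i j).1]
    simp [Finset.sum_add_distrib, hd]
    ring
  have h2 : s = d ^ 2 * r + d * q := by
    have : ∫ ω, (∑ i, ∑ j, A ω i j * A ω j i) ∂μ = s := by
      simp only [trace, diag_apply, mul_apply] at hs
      simp [hs]
    rw [← this]
    rw [integral_finsetSum _ fun i _ => integrable_finsetSum _ fun j _ => h.integrable_mul i j j i]
    simp_rw [fun i => integral_finsetSum Finset.univ
      fun j (_ : j ∈ Finset.univ) => h.integrable_mul i j j i, fun i j => (hqr i j).2]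
    simp [Finset.sum_add_distrib, hd]
    ring
  have hq : q = (d * t ^ 2 - s) / (d * (d ^ 2 - 1)) := by
    rw [h1, h2]
    field_simp
    ring
  have hr : r = (d * s - t ^ 2) / (d * (d ^ 2 - 1)) := by
    rw [h1, h2]
    field_simp
    ring
  rw [← hq, ← hr]
  exact hqr i j

end Invariance

theorem trace_fromBlocks {p n : Type*} [Fintype p] [Fintype n] (A : Matrix p p ℂ) (B : Matrix p n ℂ)
    (C : Matrix n p ℂ) (D : Matrix n n ℂ) : (fromBlocks A B C D).trace = A.trace + D.trace := by
  simp [trace]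

section Haar

variable {n : Type*} [Fintype n] [DecidableEq n]

instance : BorelSpace (Matrix n n ℂ) :=
  inferInstanceAs (BorelSpace (n → n → ℂ))

instance : CompactSpace (unitaryGroup n ℂ) := by
  refine isCompact_iff_compactSpace.mp (IsCompact.of_isClosed_subset
    (isCompact_univ_pi fun _ : n => isCompact_univ_pi fun _ : n =>
      isCompact_closedBall (0 : ℂ) 1) isClosed_unitary fun U hU => ?_)
  exact fun i _ j _ => mem_closedBall_zero_iff.mpr (entry_norm_bound_of_unitary hU i j)

variable (μ : Measure (unitaryGroup n ℂ)) [μ.IsHaarMeasure]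

theorem isMulRightInvariant [IsProbabilityMeasure μ] : μ.IsMulRightInvariant := by
  refine ⟨fun g => ?_⟩
  have : IsProbabilityMeasure (μ.map (· * g)) :=
    Measure.isProbabilityMeasure_map (by fun_prop)
  exact Measure.isHaarMeasure_eq_of_isProbabilityMeasure _ _

theorem integrable_of_continuous {f : unitaryGroup n ℂ → ℂ} (hf : Continuous f) :
    Integrable f μ :=
  hf.integrable_of_hasCompactSupport (HasCompactSupport.of_compactSpace f)

theorem conjInvariant_haar [IsProbabilityMeasure μ] (C : Matrix n n ℂ) :
    ConjInvariant μ fun U : unitaryGroup n ℂ => (U : Matrix n n ℂ)ᴴ * C * (U : Matrix n n ℂ) where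
  integrable_apply i j := integrable_of_continuous μ (by fun_prop)
  integrable_mul i j k l := integrable_of_continuous μ (by fun_prop)
  integral_conj V hV f := by
    have := isMulRightInvariant μ
    rw [← integral_mul_right_eq_self (μ := μ)
      (fun U : unitaryGroup n ℂ => f ((U : Matrix n n ℂ)ᴴ * C * (U : Matrix n n ℂ))) ⟨V, hV⟩]
    simp only [Submonoid.coe_mul, conjTranspose_mul, Matrix.mul_assoc]

theorem integral_trace_mul_conj [IsProbabilityMeasure μ] [Nonempty n] (B C : Matrix n n ℂ) :
    ∫ Y : unitaryGroup n ℂ, (B * ((Y : Matrix n n ℂ)ᴴ * C * (Y : Matrix n n ℂ))).trace ∂μ =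
      B.trace * C.trace / Fintype.card n := by
  have h := conjInvariant_haar μ C
  have ht : ∀ Y : unitaryGroup n ℂ,
      ((Y : Matrix n n ℂ)ᴴ * C * (Y : Matrix n n ℂ)).trace = C.trace := fun Y => by
    rw [Matrix.mul_assoc, trace_mul_comm, Matrix.mul_assoc, ← star_eq_conjTranspose,
      mem_unitaryGroup_iff.mp Y.2, Matrix.mul_one]
  have hY := h.integral_apply C.trace (by simp [ht])
  have expand : ∀ D : Matrix n n ℂ, (B * D).trace = ∑ i, ∑ j, B i j * D j i := fun D => by
    simp [trace, mul_apply]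
  simp_rw [expand]
  rw [integral_finsetSum _ fun i _ => integrable_finsetSum _ fun j _ =>
    (h.integrable_apply j i).const_mul (B i j)]
  simp_rw [fun i => integral_finsetSum Finset.univ
    fun j (_ : j ∈ Finset.univ) => (h.integrable_apply j i).const_mul (B i j),
    integral_const_mul, hY]
  simp [mul_div_assoc, ← Finset.sum_mul, trace]

theorem integral_trace_star (B : Matrix n n ℂ) :
    ∫ Y : unitaryGroup n ℂ, (B * (Y : Matrix n n ℂ)ᴴ).trace ∂μ = 0 :=
  integral_eq_zero_of_mul_left_eq_neg (g := -1) fun Y => by simp [Unitary.coe_neg]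

theorem integral_trace (B : Matrix n n ℂ) :
    ∫ Y : unitaryGroup n ℂ, (B * (Y : Matrix n n ℂ)).trace ∂μ = 0 :=
  integral_eq_zero_of_mul_left_eq_neg (g := -1) fun Y => by simp [Unitary.coe_neg]

theorem integral_trace_fromBlocks [IsProbabilityMeasure μ] [Nonempty n] {p : Type*} [Fintype p]
    [DecidableEq p] (A : Matrix (p ⊕ n) (p ⊕ n) ℂ) :
    ∫ Y : unitaryGroup n ℂ, (A * (fromBlocks 1 0 0 (Y : Matrix n n ℂ))ᴴ * A *
      fromBlocks 1 0 0 (Y : Matrix n n ℂ)).trace ∂μ =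
      (∑ i, ∑ j, A (Sum.inl i) (Sum.inl j) * A (Sum.inl j) (Sum.inl i)) +
      (∑ i, ∑ j, A (Sum.inr i) (Sum.inr i) * A (Sum.inr j) (Sum.inr j)) / Fintype.card n := by
  have key : ∀ Y : Matrix n n ℂ,
      (A * (fromBlocks 1 0 0 Y)ᴴ * A * fromBlocks 1 0 0 Y).trace =
      (A.toBlocks₁₁ * A.toBlocks₁₁).trace + (A.toBlocks₂₁ * A.toBlocks₁₂ * Yᴴ).trace +
        (A.toBlocks₂₁ * A.toBlocks₁₂ * Y).trace + (A.toBlocks₂₂ * (Yᴴ * A.toBlocks₂₂ * Y)).trace := by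
    intro Y
    conv_lhs => rw [← fromBlocks_toBlocks A]
    simp only [fromBlocks_conjTranspose, fromBlocks_multiply, trace_fromBlocks, conjTranspose_one,
      conjTranspose_zero, Matrix.mul_one, Matrix.mul_zero, add_zero, zero_add, trace_add,
      Matrix.add_mul]
    rw [Matrix.mul_assoc A.toBlocks₁₂, trace_mul_comm A.toBlocks₁₂, Matrix.mul_assoc Yᴴ,
      trace_mul_comm Yᴴ]
    simp only [Matrix.mul_assoc]
    ring
  simp_rw [key]
  rw [integral_add (integrable_of_continuous μ (by fun_prop))
      (integrable_of_continuous μ (by fun_prop)),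
    integral_add (integrable_of_continuous μ (by fun_prop))
      (integrable_of_continuous μ (by fun_prop)),
    integral_add (integrable_of_continuous μ (by fun_prop))
      (integrable_of_continuous μ (by fun_prop)),
    integral_trace, integral_trace_star, integral_trace_mul_conj]
  simp [trace, mul_apply, toBlocks₁₁, toBlocks₂₂, Finset.sum_mul_sum]

end Haar

end HaarMoments

/-- core computation of Theorem 2, aligned phases, orthonormal inputs:
for `1 ≤ N < d`, `m = d − N`, a Hermitian `O` on `ℂ^d = ℂ^N ⊕ ℂ^m`, and
`W(Y) = I_N ⊕ Y`,
`∫∫ Tr(U†OU·W(Y)†·U†OU·W(Y)) dHaar_m(Y) dHaar_d(U)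
  = (d N² Tr(O²) + (d² − N² − 1)(Tr O)²) / (d(d² − 1))`. -/
theorem stmt14 (d N : ℕ) (hd : 2 ≤ d) (hN : 1 ≤ N) (hNd : N < d) (m : ℕ) (hm : m = d - N)
    (O : Matrix (Fin N ⊕ Fin m) (Fin N ⊕ Fin m) ℂ) (hO : O.IsHermitian)
    (μd : Measure (Matrix.unitaryGroup (Fin N ⊕ Fin m) ℂ))
    [μd.IsHaarMeasure] [IsProbabilityMeasure μd]
    (μm : Measure (Matrix.unitaryGroup (Fin m) ℂ))
    [μm.IsHaarMeasure] [IsProbabilityMeasure μm] :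
    (∫ U, ∫ Y,
        ((U : Matrix (Fin N ⊕ Fin m) (Fin N ⊕ Fin m) ℂ)ᴴ * O *
          (U : Matrix (Fin N ⊕ Fin m) (Fin N ⊕ Fin m) ℂ) *
          (Matrix.fromBlocks 1 0 0 (Y : Matrix (Fin m) (Fin m) ℂ))ᴴ *
          ((U : Matrix (Fin N ⊕ Fin m) (Fin N ⊕ Fin m) ℂ)ᴴ * O *
            (U : Matrix (Fin N ⊕ Fin m) (Fin N ⊕ Fin m) ℂ)) *
          Matrix.fromBlocks 1 0 0 (Y : Matrix (Fin m) (Fin m) ℂ)).trace ∂μm ∂μd) =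
      ((d : ℂ) * (N : ℂ) ^ 2 * (O * O).trace +
          ((d : ℂ) ^ 2 - (N : ℂ) ^ 2 - 1) * O.trace ^ 2) /
        ((d : ℂ) * ((d : ℂ) ^ 2 - 1)) := by
  have : Nonempty (Fin m) := ⟨⟨0, by lia⟩⟩
  have : Nonempty (Fin N) := ⟨⟨0, by lia⟩⟩
  have : Nontrivial (Fin N ⊕ Fin m) :=
    ⟨Sum.inl ⟨0, by lia⟩, Sum.inr ⟨0, by lia⟩, Sum.inl_ne_inr⟩
  have hdN : (d : ℂ) = N + m := by exact_mod_cast (by lia : d = N + m)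
  have hcard : (Fintype.card (Fin N ⊕ Fin m) : ℂ) = d := by simp [hdN]
  have hm0 : (m : ℂ) ≠ 0 := by exact_mod_cast (by lia : m ≠ 0)
  have hd0 : (d : ℂ) ≠ 0 := by exact_mod_cast (by lia : d ≠ 0)
  have hd1 : (d : ℂ) ^ 2 - 1 ≠ 0 := by
    rw [sub_ne_zero]
    exact_mod_cast (Nat.one_lt_pow two_ne_zero hd).ne'
  have hA := HaarMoments.conjInvariant_haar μd O
  set A := fun U : unitaryGroup (Fin N ⊕ Fin m) ℂ =>
    (U : Matrix (Fin N ⊕ Fin m) (Fin N ⊕ Fin m) ℂ)ᴴ * O *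
      (U : Matrix (Fin N ⊕ Fin m) (Fin N ⊕ Fin m) ℂ) with hAdef
  have hUU : ∀ U : unitaryGroup (Fin N ⊕ Fin m) ℂ,
      (U : Matrix (Fin N ⊕ Fin m) (Fin N ⊕ Fin m) ℂ) *
        (U : Matrix (Fin N ⊕ Fin m) (Fin N ⊕ Fin m) ℂ)ᴴ = 1 := fun U =>
    mem_unitaryGroup_iff.mp U.2
  have hconj : ∀ (U : unitaryGroup (Fin N ⊕ Fin m) ℂ) (C : Matrix _ _ ℂ),
      ((U : Matrix (Fin N ⊕ Fin m) (Fin N ⊕ Fin m) ℂ)ᴴ * C *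
        (U : Matrix (Fin N ⊕ Fin m) (Fin N ⊕ Fin m) ℂ)).trace = C.trace := fun U C => by
    rw [Matrix.mul_assoc, trace_mul_comm, Matrix.mul_assoc, hUU, Matrix.mul_one]
  have ht : ∀ U, (A U).trace = O.trace := fun U => hconj U O
  have hs : ∀ U, (A U * A U).trace = (O * O).trace := fun U => by
    rw [← hconj U (O * O)]
    congr 1
    simp only [hAdef, Matrix.mul_assoc]
    rw [← Matrix.mul_assoc (U : Matrix (Fin N ⊕ Fin m) (Fin N ⊕ Fin m) ℂ), hUU, Matrix.one_mul]
  have hmom := hA.integral_mul ht hs hcard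
  calc _ = ∫ U, ((∑ i, ∑ j, A U (Sum.inl i) (Sum.inl j) * A U (Sum.inl j) (Sum.inl i)) +
      (∑ i, ∑ j, A U (Sum.inr i) (Sum.inr i) * A U (Sum.inr j) (Sum.inr j)) /
        Fintype.card (Fin m)) ∂μd :=
        integral_congr_ae (ae_of_all _ fun U => HaarMoments.integral_trace_fromBlocks μm (A U))
    _ = _ := by
      rw [integral_add
        (integrable_finsetSum _ fun i _ => integrable_finsetSum _ fun j _ =>
          hA.integrable_mul _ _ _ _)
        ((integrable_finsetSum _ fun i _ => integrable_finsetSum _ fun j _ =>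
          hA.integrable_mul _ _ _ _).div_const _), integral_div,
        integral_finsetSum _ fun i _ => integrable_finsetSum _ fun j _ =>
          hA.integrable_mul _ _ _ _,
        integral_finsetSum _ fun i _ => integrable_finsetSum _ fun j _ =>
          hA.integrable_mul _ _ _ _]
      simp_rw [fun i : Fin N => integral_finsetSum Finset.univ fun j (_ : j ∈ Finset.univ) =>
          hA.integrable_mul (Sum.inl i) (Sum.inl j) (Sum.inl j) (Sum.inl i),
        fun i : Fin m => integral_finsetSum Finset.univ fun j (_ : j ∈ Finset.univ) =>
          hA.integrable_mul (Sum.inr i) (Sum.inr i) (Sum.inr j) (Sum.inr j),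
        fun i j => (hmom i j).1, fun i j => (hmom i j).2, Sum.inl.injEq, Sum.inr.injEq]
      simp only [Finset.sum_add_distrib, Finset.sum_ite_eq, Finset.sum_const, Finset.card_univ,
        Fintype.card_fin, nsmul_eq_mul, Finset.mem_univ, if_true]
      field_simp
      rw [hdN]
      ring
end
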